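/- Let μ ≥ 0 and let h, w : ℝ × ℝ → ℝ be smooth (C^∞) functions of (t,x), with w(t,·) compactly supported in x for each t. For each fixed t, let 𝒯 act in the space variable with coefficient h(t,·): (𝒯w)(t,x) = h(t,x)·w(t,x) − (μ/3)·∂_x( h(t,x)³·∂_x w(t,x) ). Then for every t, ∫_ℝ [ ∂_t( (𝒯w)(t,x) ) − (𝒯(∂_t w))(t,x) ] · w(t,x) dx = ∫_ℝ ∂_t h(t,x) · w(t,x)² dx + (μ/3) ∫_ℝ ∂_t( h(t,x)³ ) · (∂_x w(t,x))² dx. -/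

import Mathlib

open MeasureTheory

/-- The operator `𝒯` acting in the space variable with time-dependent coefficient
`h(t,·)`: `(𝒯w)(t,x) = h(t,x)·w(t,x) − (μ/3)·∂ₓ( h(t,x)³·∂ₓw(t,x) )`. -/
noncomputable def Tcal (μ : ℝ) (h w : ℝ → ℝ → ℝ) (t x : ℝ) : ℝ :=
  h t x * w t x - μ / 3 * deriv (fun y => (h t y)^3 * deriv (fun y' => w t y') y) x

open scoped ContDiff

section PartialDerivatives

variable {f : ℝ → ℝ → ℝ}

theorem hasDerivAt_fst_of_contDiff (hf : ContDiff ℝ ∞ (fun z : ℝ × ℝ => f z.1 z.2)) (t x : ℝ) :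
    HasDerivAt (fun s => f s x) (fderiv ℝ (fun z : ℝ × ℝ => f z.1 z.2) (t, x) (1, 0)) t :=
  HasFDerivAt.comp_hasDerivAt (l := fun z : ℝ × ℝ => f z.1 z.2) t
    (hf.differentiable (by simp) (t, x)).hasFDerivAt
    ((hasDerivAt_id' t).prodMk (hasDerivAt_const t x))

theorem hasDerivAt_snd_of_contDiff (hf : ContDiff ℝ ∞ (fun z : ℝ × ℝ => f z.1 z.2)) (t x : ℝ) :
    HasDerivAt (fun y => f t y) (fderiv ℝ (fun z : ℝ × ℝ => f z.1 z.2) (t, x) (0, 1)) x :=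
  HasFDerivAt.comp_hasDerivAt (l := fun z : ℝ × ℝ => f z.1 z.2) x
    (hf.differentiable (by simp) (t, x)).hasFDerivAt
    ((hasDerivAt_const x t).prodMk (hasDerivAt_id' x))

theorem contDiff_fderiv_apply_const {g : ℝ × ℝ → ℝ} (hg : ContDiff ℝ ∞ g) (v : ℝ × ℝ) :
    ContDiff ℝ ∞ (fun z => fderiv ℝ g z v) :=
  (hg.fderiv_right (m := ∞) (by simp)).clm_apply contDiff_const

theorem contDiff_deriv_fst (hf : ContDiff ℝ ∞ (fun z : ℝ × ℝ => f z.1 z.2)) :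
    ContDiff ℝ ∞ (fun z : ℝ × ℝ => deriv (fun s => f s z.2) z.1) := by
  simpa only [(hasDerivAt_fst_of_contDiff hf _ _).deriv] using
    contDiff_fderiv_apply_const hf (1, 0)

theorem contDiff_deriv_snd (hf : ContDiff ℝ ∞ (fun z : ℝ × ℝ => f z.1 z.2)) :
    ContDiff ℝ ∞ (fun z : ℝ × ℝ => deriv (fun y => f z.1 y) z.2) := by
  simpa only [(hasDerivAt_snd_of_contDiff hf _ _).deriv] using
    contDiff_fderiv_apply_const hf (0, 1)

theorem deriv_fst_deriv_snd_comm (hf : ContDiff ℝ ∞ (fun z : ℝ × ℝ => f z.1 z.2)) (t x : ℝ) :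
    deriv (fun s => deriv (fun y => f s y) x) t = deriv (fun y => deriv (fun s => f s y) t) x := by
  have hd : DifferentiableAt ℝ (fderiv ℝ (fun z : ℝ × ℝ => f z.1 z.2)) (t, x) :=
    (hf.fderiv_right (m := ∞) (by simp)).differentiable (by simp) _
  have hsymm : IsSymmSndFDerivAt ℝ (fun z : ℝ × ℝ => f z.1 z.2) (t, x) :=
    hf.contDiffAt.isSymmSndFDerivAt 
      (by simpa using WithTop.coe_le_coe.2 (le_top : (2 : ℕ∞) ≤ ⊤))
  simp only [(hasDerivAt_snd_of_contDiff hf _ _).deriv, (hasDerivAt_fst_of_contDiff hf _ _).deriv]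
  rw [(hasDerivAt_fst_of_contDiff (f := fun s y => fderiv ℝ (fun z : ℝ × ℝ => f z.1 z.2) (s, y)
      (0, 1)) (contDiff_fderiv_apply_const hf (0, 1)) t x).deriv,
    (hasDerivAt_snd_of_contDiff (f := fun s y => fderiv ℝ (fun z : ℝ × ℝ => f z.1 z.2) (s, y)
      (1, 0)) (contDiff_fderiv_apply_const hf (1, 0)) t x).deriv]
  simp only [Prod.mk.eta]
  rw [fderiv_clm_apply hd (by fun_prop), fderiv_clm_apply hd (by fun_prop)]
  simpa using hsymm.eq (1, 0) (0, 1)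

end PartialDerivatives

/-- The commutator `[∂_t, 𝒯]` is the operator `𝒯` with coefficients differentiated in time. -/
theorem deriv_Tcal_sub_Tcal_deriv (μ : ℝ) {h w : ℝ → ℝ → ℝ}
    (hh : ContDiff ℝ ∞ (fun z : ℝ × ℝ => h z.1 z.2))
    (hw : ContDiff ℝ ∞ (fun z : ℝ × ℝ => w z.1 z.2)) (t x : ℝ) :
    deriv (fun s => Tcal μ h w s x) t - Tcal μ h (fun s y => deriv (fun s' => w s' y) s) t x
      = deriv (fun s => h s x) t * w t x
        - μ / 3 * deriv (fun y => deriv (fun s => (h s y) ^ 3) t * deriv (fun y' => w t y') y) x := by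
  have hh3 : ContDiff ℝ ∞ (fun z : ℝ × ℝ => (h z.1 z.2) ^ 3) := hh.pow 3
  have hwx := contDiff_deriv_snd hw
  have hwt := contDiff_deriv_fst hw
  have hflux := hh3.mul hwx
  have diff_fst {f : ℝ → ℝ → ℝ} (hf : ContDiff ℝ ∞ (fun z : ℝ × ℝ => f z.1 z.2)) (y : ℝ) :
      DifferentiableAt ℝ (fun s => f s y) t :=
    (hasDerivAt_fst_of_contDiff hf t y).differentiableAt
  have diff_snd {f : ℝ → ℝ → ℝ} (hf : ContDiff ℝ ∞ (fun z : ℝ × ℝ => f z.1 z.2)) :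
      DifferentiableAt ℝ (fun y => f t y) x :=
    (hasDerivAt_snd_of_contDiff hf t x).differentiableAt
  have flux_deriv (y : ℝ) :
      deriv (fun s => (h s y) ^ 3 * deriv (fun y' => w s y') y) t
        = deriv (fun s => (h s y) ^ 3) t * deriv (fun y' => w t y') y
          + (h t y) ^ 3 * deriv (fun y' => deriv (fun s => w s y') t) y := by
    rw [← deriv_fst_deriv_snd_comm hw]
    exact deriv_fun_mul (diff_fst (f := fun s y => (h s y) ^ 3) hh3 y)
      (diff_fst (f := fun s y => deriv (fun y' => w s y') y) hwx y)
  have flux_comm := deriv_fst_deriv_snd_comm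
    (f := fun s y => (h s y) ^ 3 * deriv (fun y' => w s y') y) hflux t x
  simp only [flux_deriv] at flux_comm
  rw [deriv_fun_add
    (diff_snd (f := fun s y => deriv (fun s' => (h s' y) ^ 3) s * deriv (fun y' => w s y') y)
      ((contDiff_deriv_fst (f := fun s y => (h s y) ^ 3) hh3).mul hwx))
    (diff_snd (f := fun s y => (h s y) ^ 3 * deriv (fun y' => deriv (fun s' => w s' y') s) y)
      (hh3.mul (contDiff_deriv_snd (f := fun s y => deriv (fun s' => w s' y) s) hwt)))]
    at flux_comm
  have hTx : DifferentiableAt ℝ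
      (fun s => deriv (fun y => (h s y) ^ 3 * deriv (fun y' => w s y') y) x) t :=
    diff_fst (f := fun s x => deriv (fun y => (h s y) ^ 3 * deriv (fun y' => w s y') y) x)
      (contDiff_deriv_snd (f := fun s y => (h s y) ^ 3 * deriv (fun y' => w s y') y) hflux) x
  unfold Tcal
  rw [deriv_fun_sub ((diff_fst hh x).fun_mul (diff_fst hw x)) (hTx.const_mul _),
    deriv_fun_mul (diff_fst hh x) (diff_fst hw x), deriv_const_mul _ hTx, flux_comm]
  ring

/-- Integration by parts for the quadratic form of `w ↦ (a w')'` on compactly supported `w`. -/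
theorem integral_deriv_mul_deriv_mul_self {a w : ℝ → ℝ} (ha : ContDiff ℝ ∞ a)
    (hw : ContDiff ℝ ∞ w) (hc : HasCompactSupport w) :
    ∫ x, deriv (fun y => a y * deriv w y) x * w x = - ∫ x, a x * (deriv w x) ^ 2 := by
  have hw' : ContDiff ℝ ∞ (deriv w) := (contDiff_infty_iff_deriv.1 hw).2
  have hg : ContDiff ℝ ∞ (fun y => a y * deriv w y) := ha.mul hw'
  have hg' : ContDiff ℝ ∞ (deriv fun y => a y * deriv w y) := (contDiff_infty_iff_deriv.1 hg).2
  have key := integral_mul_deriv_eq_deriv_mul_of_integrable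
    (u := fun y => a y * deriv w y) (v := w)
    (fun x _ => (hg.differentiable (by simp) x).hasDerivAt)
    (fun x _ => (hw.differentiable (by simp) x).hasDerivAt)
    ((hg.mul hw').continuous.integrable_of_hasCompactSupport hc.deriv.mul_left)
    ((hg'.mul hw).continuous.integrable_of_hasCompactSupport hc.mul_left)
    ((hg.mul hw).continuous.integrable_of_hasCompactSupport hc.mul_left)
  rw [← neg_eq_iff_eq_neg, ← key]
  exact integral_congr_ae (.of_forall fun x => by ring)

/-- Quadratic-form identity for the time commutator `([∂_t, 𝒯]w, w)_{L²}`: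
the key commutator computation in the energy estimate for the Boussinesq–Peregrine
system with a time-dependent bottom. -/
theorem Tcal_time_commutator_identity
    (μ : ℝ) (hμ : 0 ≤ μ) (h w : ℝ → ℝ → ℝ)
    (hh : ContDiff ℝ (⊤ : ℕ∞) (fun z : ℝ × ℝ => h z.1 z.2))
    (hw : ContDiff ℝ (⊤ : ℕ∞) (fun z : ℝ × ℝ => w z.1 z.2))
    (hw_supp : ∀ t : ℝ, HasCompactSupport (fun x => w t x)) :
    ∀ t : ℝ,
      ∫ x : ℝ,
          (deriv (fun s => Tcal μ h w s x) t
            - Tcal μ h (fun s y => deriv (fun s' => w s' y) s) t x) * w t x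
        = (∫ x : ℝ, deriv (fun s => h s x) t * (w t x)^2)
          + μ / 3 * ∫ x : ℝ, deriv (fun s => (h s x)^3) t * (deriv (fun y => w t y) x)^2 := by
  intro t
  have hslice : ContDiff ℝ ∞ (fun x : ℝ => (t, x)) := contDiff_const.prodMk contDiff_id
  have hwt : ContDiff ℝ ∞ (fun x => w t x) := hw.comp hslice
  have hht : ContDiff ℝ ∞ (fun x => deriv (fun s => h s x) t) :=
    (contDiff_deriv_fst hh).comp hslice
  have ha : ContDiff ℝ ∞ (fun x => deriv (fun s => (h s x) ^ 3) t) :=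
    (contDiff_deriv_fst (f := fun s y => (h s y) ^ 3) (hh.pow 3)).comp hslice
  have hflux' : ContDiff ℝ ∞
      (deriv fun y => deriv (fun s => (h s y) ^ 3) t * deriv (fun y' => w t y') y) :=
    (contDiff_infty_iff_deriv.1 (ha.mul (contDiff_infty_iff_deriv.1 hwt).2)).2
  have hint : Integrable (fun x => deriv (fun s => h s x) t * (w t x) ^ 2) := by
    simpa only [sq] using (hht.mul (hwt.mul hwt)).continuous.integrable_of_hasCompactSupport
      ((hw_supp t).mul_left.mul_left)
  have hint' : Integrable (fun x =>
      deriv (fun y => deriv (fun s => (h s y) ^ 3) t * deriv (fun y' => w t y') y) x * w t x) :=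
    (hflux'.mul hwt).continuous.integrable_of_hasCompactSupport (hw_supp t).mul_left
  have hparts := integral_deriv_mul_deriv_mul_self ha hwt (hw_supp t)
  rw [← neg_eq_iff_eq_neg.2 hparts, mul_neg, ← sub_eq_add_neg, ← integral_const_mul,
    ← integral_sub hint (hint'.const_mul _)]
  refine integral_congr_ae (.of_forall fun x => ?_)
  simp only [deriv_Tcal_sub_Tcal_deriv μ hh hw]
  ring
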